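/- arXiv:2511.10511 — 3 statements merged into one kernel-verified Lean document; each statement's English description precedes it below -/
import Mathlib

section
/- Let A be a unitary superalgebra over F such that A₀ ⊄ Z(A), such that A = F·1 ⊕ J(A) as F-vector spaces (J(A) the Jacobson radical), and such that J' = J(A) ∩ Z(A) is a graded two-sided ideal of A (i.e., J' is an ideal with J' = (J' ∩ A₀) ⊕ (J' ∩ A₁)). Then C^gr(A) is a two-sided ideal of F⟨Y,Z⟩ (hence a T₂-ideal): for every f ∈ C^gr(A) and every g, h ∈ F⟨Y,Z⟩, the product g·f·h again belongs to C^gr(A). -/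
noncomputable section

/-- The free superalgebra `F⟨Y,Z⟩`: the free unital associative `F`-algebra on the
even variables `Sum.inl i` (representing `y_{i+1}`) and the odd variables
`Sum.inr j` (representing `z_{j+1}`). -/
abbrev FA (F : Type) [Field F] : Type := FreeAlgebra F (ℕ ⊕ ℕ)

variable (F : Type) [Field F]

/-- the even variable `y_{i+1}` -/
def yv (i : ℕ) : FA F := FreeAlgebra.ι F (Sum.inl i)

/-- the odd variable `z_{j+1}` -/
def zv (j : ℕ) : FA F := FreeAlgebra.ι F (Sum.inr j)

/-- the constant term of an element of `F⟨Y,Z⟩` -/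
def constTerm : FA F →ₐ[F] F := FreeAlgebra.lift F (fun _ => (0 : F))

/-- the commutator `[a,b] = ab - ba` -/
def brk {R : Type} [Ring R] (a b : R) : R := a * b - b * a

/-- the left-normed commutator `[a, l₁, l₂, …]` -/
def lnc {R : Type} [Ring R] (a : R) (l : List R) : R := l.foldl brk a

section SuperAlg

variable (B : Type) [Ring B] [Algebra F B]

/-- the center of the (possibly non-unital) subalgebra of `B` whose underlying
subspace is `S`, as a submodule of `B` -/
def centerIn (S : Submodule F B) : Submodule F B where
  carrier := {x | x ∈ S ∧ ∀ y ∈ S, x * y = y * x}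
  add_mem' := by
    rintro a b ⟨ha, ha'⟩ ⟨hb, hb'⟩
    exact ⟨S.add_mem ha hb, fun y hy => by rw [add_mul, mul_add, ha' y hy, hb' y hy]⟩
  zero_mem' := ⟨S.zero_mem, fun y _ => by rw [zero_mul, mul_zero]⟩
  smul_mem' := by
    rintro c a ⟨ha, ha'⟩
    exact ⟨S.smul_mem c ha, fun y hy => by rw [smul_mul_assoc, mul_smul_comm, ha' y hy]⟩

variable (A0 A1 : Submodule F B)

/-- a graded substitution: an algebra evaluation sending each `yᵢ` into the even
component `A0` and each `zⱼ` into the odd component `A1` -/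
def IsGSubst (φ : FA F →ₐ[F] B) : Prop :=
  (∀ i, φ (yv F i) ∈ A0) ∧ (∀ j, φ (zv F j) ∈ A1)

/-- the graded identities of the superalgebra with even part `A0` and odd part `A1` -/
def IdGr : Submodule F (FA F) where
  carrier := {f | ∀ φ : FA F →ₐ[F] B, IsGSubst F B A0 A1 φ → φ f = 0}
  add_mem' := by
    intro f g hf hg φ hφ
    rw [map_add, hf φ hφ, hg φ hφ, add_zero]
  zero_mem' := fun φ _ => map_zero φ
  smul_mem' := by
    intro c f hf φ hφ
    rw [map_smul, hf φ hφ, smul_zero]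

/-- the central graded polynomials of the superalgebra with even part `A0` and
odd part `A1`: the polynomials with zero constant term all of whose graded
evaluations lie in the center of the superalgebra -/
def CGr : Submodule F (FA F) where
  carrier := {f | constTerm F f = 0 ∧
    ∀ φ : FA F →ₐ[F] B, IsGSubst F B A0 A1 φ → φ f ∈ centerIn F B (A0 ⊔ A1)}
  add_mem' := by
    rintro f g ⟨hf0, hf⟩ ⟨hg0, hg⟩
    refine ⟨by rw [map_add, hf0, hg0, add_zero], fun φ hφ => ?_⟩
    rw [map_add]
    exact (centerIn F B (A0 ⊔ A1)).add_mem (hf φ hφ) (hg φ hφ)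
  zero_mem' :=
    ⟨map_zero _, fun φ _ => by
      rw [map_zero]; exact (centerIn F B (A0 ⊔ A1)).zero_mem⟩
  smul_mem' := by
    rintro c f ⟨hf0, hf⟩
    refine ⟨by rw [map_smul, hf0, smul_zero], fun φ hφ => ?_⟩
    rw [map_smul]
    exact (centerIn F B (A0 ⊔ A1)).smul_mem c (hf φ hφ)

end SuperAlg

/-- the space `P_n^{gr}` of multilinear graded polynomials of degree `n`,
spanned by `w_{σ(1)} ⋯ w_{σ(n)}` with `wᵢ ∈ {yᵢ, zᵢ}` -/
def PnGr (n : ℕ) : Submodule F (FA F) :=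
  Submodule.span F
    {m : FA F | ∃ (σ : Equiv.Perm (Fin n)) (w : Fin n → Bool),
      m = (List.ofFn fun i : Fin n =>
        if w (σ i) then zv F (σ i).val else yv F (σ i).val).prod}

/-- `dim P / (P ∩ C)` -/
def scodim (P C : Submodule F (FA F)) : ℕ :=
  Module.finrank F (↥P ⧸ Submodule.comap P.subtype C)

/-- `dim (P ⊓ C) / (P ⊓ I)` -/
def deltaDim (P C I : Submodule F (FA F)) : ℕ :=
  Module.finrank F (↥(P ⊓ C) ⧸ Submodule.comap (P ⊓ C).subtype (P ⊓ I))

/-- the parity automorphism of `F⟨Y,Z⟩`, fixing the `yᵢ` and negating the `zⱼ` -/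
def omegaFA : FA F →ₐ[F] FA F :=
  FreeAlgebra.lift F (fun v => match v with
    | Sum.inl i => FreeAlgebra.ι F (Sum.inl i)
    | Sum.inr j => - FreeAlgebra.ι F (Sum.inr j))

/-- an even (degree-0) element of the free superalgebra -/
def IsEvenFA (f : FA F) : Prop := omegaFA F f = f

/-- an odd (degree-1) element of the free superalgebra -/
def IsOddFA (f : FA F) : Prop := omegaFA F f = - f

/-- a graded endomorphism of the free superalgebra: sends `Y`-variables to even
elements and `Z`-variables to odd elements -/
def IsT2Endo (φ : FA F →ₐ[F] FA F) : Prop :=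
  (∀ i, IsEvenFA F (φ (yv F i))) ∧ (∀ j, IsOddFA F (φ (zv F j)))

/-- a T₂-space: a subspace invariant under all graded endomorphisms -/
def IsT2Space (V : Submodule F (FA F)) : Prop :=
  ∀ φ : FA F →ₐ[F] FA F, IsT2Endo F φ → ∀ f ∈ V, φ f ∈ V

/-- the smallest T₂-space of `F⟨Y,Z⟩` containing `S` -/
def T2SpaceGen (S : Set (FA F)) : Submodule F (FA F) :=
  sInf {V : Submodule F (FA F) | S ⊆ ↑V ∧ IsT2Space F V}

/-- a T₂-ideal: a two-sided ideal invariant under all graded endomorphisms -/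
def IsT2Ideal (I : Submodule F (FA F)) : Prop :=
  (∀ f ∈ I, ∀ g : FA F, g * f ∈ I ∧ f * g ∈ I) ∧ IsT2Space F I

/-- the smallest T₂-ideal of `F⟨Y,Z⟩` containing `S` -/
def T2IdealGen (S : Set (FA F)) : Submodule F (FA F) :=
  sInf {I : Submodule F (FA F) | S ⊆ ↑I ∧ IsT2Ideal F I}

/-- the products `z_{i₁}⋯z_{i_k} · w₁⋯w_s` where every `wⱼ` is a left-normed
commutator of weight ≥ 2 in the variables and `k + s ≥ 1`; proper
ℤ₂-polynomials are the linear combinations of these -/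
def properProds : Set (FA F) :=
  {p | ∃ (zs : List ℕ) (ws : List (FA F)),
      (∀ w ∈ ws, ∃ (v : ℕ ⊕ ℕ) (l : List (ℕ ⊕ ℕ)), l ≠ [] ∧
        w = lnc (FreeAlgebra.ι F v) (l.map (FreeAlgebra.ι F))) ∧
      1 ≤ zs.length + ws.length ∧
      p = (zs.map (zv F)).prod * ws.prod}

/-- the Jacobson radical `J(A)`, as an `F`-submodule of `A` -/
def Jrad (A : Type) [Ring A] [Algebra F A] : Submodule F A :=
  Submodule.restrictScalars F ((⊥ : Ideal A).jacobson)

/-- `J' = J(A) ∩ Z(A)` -/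
def Jprime (A : Type) [Ring A] [Algebra F A] : Submodule F A :=
  Jrad F A ⊓ Subalgebra.toSubmodule (Subalgebra.center F A)

/-- the matrix unit `e_{i+1,j+1}` (0-indexed position `(i,j)`) -/
def eMat (k i j : ℕ) : Matrix (Fin k) (Fin k) F :=
  Matrix.of fun a b => if (a : ℕ) = i ∧ (b : ℕ) = j then 1 else 0

/-- the matrix `E = e_{12} + e_{23} + ⋯ + e_{k-1,k}` -/
def EMat (k : ℕ) : Matrix (Fin k) (Fin k) F :=
  Matrix.of fun a b => if (a : ℕ) + 1 = (b : ℕ) then 1 else 0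

/-- `N_k = span_F{I_k, E, …, E^{k-2}, e_{12}, …, e_{1k}}` -/
def NkSub (k : ℕ) : Submodule F (Matrix (Fin k) (Fin k) F) :=
  Submodule.span F
    ({1} ∪ {x | ∃ m, 1 ≤ m ∧ m ≤ k - 2 ∧ x = EMat F k ^ m}
      ∪ {x | ∃ j, 1 ≤ j ∧ j ≤ k - 1 ∧ x = eMat F k 0 j})

/-- `A_k = span_F{e_{11}, E, …, E^{k-2}, e_{12}, …, e_{1k}}` -/
def AkSub (k : ℕ) : Submodule F (Matrix (Fin k) (Fin k) F) :=
  Submodule.span F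
    ({eMat F k 0 0} ∪ {x | ∃ m, 1 ≤ m ∧ m ≤ k - 2 ∧ x = EMat F k ^ m}
      ∪ {x | ∃ j, 1 ≤ j ∧ j ≤ k - 1 ∧ x = eMat F k 0 j})

/-- `B_k = span_F{e_{kk}, E, …, E^{k-2}, e_{1k}, …, e_{k-1,k}}` -/
def BkSub (k : ℕ) : Submodule F (Matrix (Fin k) (Fin k) F) :=
  Submodule.span F
    ({eMat F k (k - 1) (k - 1)} ∪ {x | ∃ m, 1 ≤ m ∧ m ≤ k - 2 ∧ x = EMat F k ^ m}
      ∪ {x | ∃ i, i ≤ k - 2 ∧ x = eMat F k i (k - 1)})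

/-- the even part of `Matrix (Fin k) (Fin k) F` under the elementary ℤ₂-grading
induced by `(0,1,…,1)`: matrices vanishing at the odd positions `(i,j)`
(those where exactly one of `i`, `j` equals the first index) -/
def matEvenPart (k : ℕ) : Submodule F (Matrix (Fin k) (Fin k) F) where
  carrier := {x | ∀ i j : Fin k, (((i : ℕ) = 0) ↔ ¬((j : ℕ) = 0)) → x i j = 0}
  add_mem' := by
    intro a b ha hb i j h
    simp [Matrix.add_apply, ha i j h, hb i j h]
  zero_mem' := by intro i j _; simp
  smul_mem' := by
    intro c a ha i j h
    simp [Matrix.smul_apply, ha i j h]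

/-- the odd part of `Matrix (Fin k) (Fin k) F` under the elementary ℤ₂-grading
induced by `(0,1,…,1)`: matrices vanishing at the even positions -/
def matOddPart (k : ℕ) : Submodule F (Matrix (Fin k) (Fin k) F) where
  carrier := {x | ∀ i j : Fin k, (((i : ℕ) = 0) ↔ ((j : ℕ) = 0)) → x i j = 0}
  add_mem' := by
    intro a b ha hb i j h
    simp [Matrix.add_apply, ha i j h, hb i j h]
  zero_mem' := by intro i j _; simp
  smul_mem' := by
    intro c a ha i j h
    simp [Matrix.smul_apply, ha i j h]

section Grassmann

variable (M : Type) [AddCommGroup M] [Module F M]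

/-- the main involution of the Grassmann (exterior) algebra, negating the
generators -/
def grassInvol : ExteriorAlgebra F M →ₐ[F] ExteriorAlgebra F M :=
  ExteriorAlgebra.lift F ⟨-(ExteriorAlgebra.ι F (M := M)), fun m => by
    simp [ExteriorAlgebra.ι_sq_zero]⟩

/-- the even (degree-0) part of the canonical ℤ₂-grading of the Grassmann
algebra: the span of `1` and the products of the generators of even length -/
def grEven : Submodule F (ExteriorAlgebra F M) :=
  LinearMap.ker ((grassInvol F M).toLinearMap - LinearMap.id)

/-- the odd (degree-1) part of the canonical ℤ₂-grading of the Grassmann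
algebra: the span of the products of the generators of odd length -/
def grOdd : Submodule F (ExteriorAlgebra F M) :=
  LinearMap.ker ((grassInvol F M).toLinearMap + LinearMap.id)

end Grassmann

end

open Polynomial in
/-- a nonconstant one-variable polynomial that is central on a subspace containing `1`
forces this subspace to be central -/
lemma central_of_poly {F : Type} [Field F] [CharZero F] {A : Type} [Ring A] [Algebra F A]
    (A0 : Submodule F A) (h1 : (1 : A) ∈ A0) (n : ℕ) :
    ∀ q : F[X], q.natDegree ≤ n + 1 → q.coeff (n + 1) ≠ 0 →
      (∀ a ∈ A0, aeval a q ∈ Subalgebra.center F A) →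
      ∀ a ∈ A0, a ∈ Subalgebra.center F A := by
  induction n with
  | zero =>
    intro q hd hc hq a ha
    have h := hq a ha
    rw [eq_X_add_C_of_natDegree_le_one hd] at h
    simp only [map_add, map_mul, aeval_C, aeval_X] at h
    have h2 := (Subalgebra.center F A).sub_mem h
      ((Subalgebra.center F A).algebraMap_mem (q.coeff 0))
    rw [add_sub_cancel_right, ← Algebra.smul_def] at h2
    have h3 := (Subalgebra.center F A).smul_mem h2 (q.coeff 1)⁻¹
    rwa [smul_smul, inv_mul_cancel₀ (by simpa using hc), one_smul] at h3
  | succ n ih =>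
    intro q hd hc hq
    have hdeg : q.natDegree = n + 1 + 1 := le_antisymm hd (le_natDegree_of_ne_zero hc)
    apply ih (taylor 1 q - q)
    · rw [natDegree_le_iff_coeff_eq_zero]
      intro N hN
      rw [coeff_sub]
      rcases eq_or_lt_of_le (Nat.succ_le_of_lt hN) with h | h
      · have h' : N = q.natDegree := by omega
        rw [h', coeff_taylor_natDegree, leadingCoeff, sub_self]
      · rw [coeff_eq_zero_of_natDegree_lt (by rw [natDegree_taylor]; omega),
          coeff_eq_zero_of_natDegree_lt (by omega), sub_self]
    · rw [coeff_sub, taylor_coeff]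
      have hl : (hasseDeriv (n + 1) q).natDegree ≤ 1 := by
        refine (natDegree_hasseDeriv_le q (n + 1)).trans ?_
        omega
      rw [eq_X_add_C_of_natDegree_le_one hl]
      simp only [eval_add, eval_mul, eval_C, eval_X, hasseDeriv_coeff]
      have e1 : 1 + (n + 1) = n + 1 + 1 := by omega
      rw [e1, Nat.choose_succ_self_right]
      simp only [zero_add, Nat.choose_self, Nat.cast_one, one_mul, mul_one, add_sub_cancel_right]
      exact mul_ne_zero (Nat.cast_ne_zero.2 (by omega)) hc
    · intro a ha
      rw [map_sub, taylor_apply, aeval_comp]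
      refine (Subalgebra.center F A).sub_mem ?_ (hq a ha)
      apply hq
      simpa using A0.add_mem ha h1

/-- for a unitary superalgebra `A` with `A₀ ⊄ Z(A)`,
`A = F·1 ⊕ J(A)`, and `J' = J(A) ∩ Z(A)` a graded two-sided ideal of `A`,
the set `C^gr(A)` of central graded polynomials is a two-sided ideal of
`F⟨Y,Z⟩` (hence a T₂-ideal). -/
theorem stmt1 (F : Type) [Field F] [CharZero F]
    (A : Type) [Ring A] [Algebra F A] (A0 A1 : Submodule F A)
    (hgr_sum : A0 ⊔ A1 = ⊤) (hgr_disj : A0 ⊓ A1 = ⊥)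
    (h00 : ∀ a ∈ A0, ∀ b ∈ A0, a * b ∈ A0)
    (h11 : ∀ a ∈ A1, ∀ b ∈ A1, a * b ∈ A0)
    (h01 : ∀ a ∈ A0, ∀ b ∈ A1, a * b ∈ A1)
    (h10 : ∀ a ∈ A1, ∀ b ∈ A0, a * b ∈ A1)
    (hA0 : ¬ A0 ≤ Subalgebra.toSubmodule (Subalgebra.center F A))
    (hdec_sum : Submodule.span F {(1 : A)} ⊔ Jrad F A = ⊤)
    (hdec_int : Submodule.span F {(1 : A)} ⊓ Jrad F A = ⊥)
    (hJ'ideal : ∀ x ∈ Jprime F A, ∀ a : A,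
      a * x ∈ Jprime F A ∧ x * a ∈ Jprime F A)
    (hJ'graded : Jprime F A = (Jprime F A ⊓ A0) ⊔ (Jprime F A ⊓ A1)) :
    ∀ f ∈ CGr F A A0 A1, ∀ g h : FA F, g * f * h ∈ CGr F A A0 A1 := by
  intro f hf g h
  obtain ⟨hf0, hf⟩ := hf
  have disj : ∀ x, x ∈ A0 → x ∈ A1 → x = 0 := fun x hx0 hx1 => by
    have : x ∈ A0 ⊓ A1 := ⟨hx0, hx1⟩
    rwa [hgr_disj, Submodule.mem_bot] at this
  have split : ∀ x : A, ∃ x0 ∈ A0, ∃ x1 ∈ A1, x0 + x1 = x := fun x => by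
    have : x ∈ A0 ⊔ A1 := by rw [hgr_sum]; trivial
    exact Submodule.mem_sup.1 this
  have cent : ∀ x, x ∈ centerIn F A (A0 ⊔ A1) ↔ x ∈ Subalgebra.center F A := fun x => by
    rw [Subalgebra.mem_center_iff, hgr_sum]
    exact ⟨fun hx b => (hx.2 b trivial).symm, fun hx => ⟨trivial, fun b _ => (hx b).symm⟩⟩
  have hone : (1 : A) ∈ A0 := by
    obtain ⟨e0, he0, e1, he1, he⟩ := split 1
    have k1 : e0 * e1 = 0 := by
      apply disj _ _ (h01 _ he0 _ he1)
      have : e0 * e1 = e0 - e0 * e0 := by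
        have h' : e0 * (e0 + e1) = e0 := by rw [he, mul_one]
        rw [mul_add] at h'
        exact eq_sub_of_add_eq' h'
      rw [this]
      exact A0.sub_mem he0 (h00 _ he0 _ he0)
    have k2 : e1 * e1 = 0 := by
      apply disj _ (h11 _ he1 _ he1)
      have : e1 * e1 = e1 - e1 * e0 := by
        have h' : e1 * (e0 + e1) = e1 := by rw [he, mul_one]
        rw [mul_add] at h'
        exact eq_sub_of_add_eq' h'
      rw [this]
      exact A1.sub_mem he1 (h10 _ he1 _ he0)
    have k3 : e1 = 0 := by
      have h' : (e0 + e1) * e1 = e1 := by rw [he, one_mul]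
      rw [add_mul, k1, k2, add_zero] at h'
      exact h'.symm
    rw [k3, add_zero] at he
    rwa [← he]
  have hJ1 : (1 : A) ∉ Jrad F A := by
    intro hJ
    have : (1 : A) ∈ Submodule.span F {(1 : A)} ⊓ Jrad F A :=
      ⟨Submodule.mem_span_singleton_self 1, hJ⟩
    rw [hdec_int, Submodule.mem_bot] at this
    apply hA0
    intro a _
    rw [← mul_one a, this, mul_zero]
    exact Submodule.zero_mem _
  have dec : ∀ x : A, ∃ c : F, x - algebraMap F A c ∈ Jrad F A := fun x => by
    have : x ∈ Submodule.span F {(1 : A)} ⊔ Jrad F A := by rw [hdec_sum]; trivial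
    obtain ⟨u, hu, j, hj, rfl⟩ := Submodule.mem_sup.1 this
    obtain ⟨c, rfl⟩ := Submodule.mem_span_singleton.1 hu
    refine ⟨c, ?_⟩
    rw [Algebra.algebraMap_eq_smul_one, add_sub_cancel_left]
    exact hj
  have hA1J : ∀ z ∈ A1, z ∈ Jrad F A := by
    intro z hz
    obtain ⟨c, hc⟩ := dec z
    by_cases hc0 : c = 0
    · simpa [hc0] using hc
    exfalso
    obtain ⟨v, hv⟩ := Ideal.mem_jacobson_iff.1
      (show z - algebraMap F A c ∈ (⊥ : Ideal A).jacobson from hc)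
      (algebraMap F A (2 * c)⁻¹)
    have hv' : ((2 * c)⁻¹ • v) * (z + algebraMap F A c) = 1 := by
      have h2c : (2 * c)⁻¹ * c + (2 * c)⁻¹ * c = 1 := by field_simp; norm_num
      have := sub_eq_zero.1 ((Submodule.mem_bot A).1 hv)
      rw [← this]
      have e : c • (2 * c)⁻¹ • v = v - (2 * c)⁻¹ • c • v := by
        rw [eq_sub_iff_add_eq, smul_comm, smul_smul, ← add_smul, h2c, one_smul]
      conv_rhs => rw [mul_assoc, ← Algebra.smul_def]
      simp only [Algebra.algebraMap_eq_smul_one, mul_add, smul_mul_assoc, mul_smul_comm,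
        mul_one, mul_sub, smul_sub]
      rw [e]
      abel
    obtain ⟨w0, hw0, w1, hw1, hw⟩ := split ((2 * c)⁻¹ • v)
    rw [← hw] at hv'
    simp only [Algebra.algebraMap_eq_smul_one, mul_add, add_mul, mul_smul_comm, mul_one,
      smul_add] at hv'
    have hodd : w0 * z + c • w1 = 0 := by
      apply disj _ _ (A1.add_mem (h01 _ hw0 _ hz) (A1.smul_mem c hw1))
      have : w0 * z + c • w1 = 1 - (w1 * z + c • w0) := by rw [← hv']; abel
      rw [this]
      exact A0.sub_mem hone (A0.add_mem (h11 _ hw1 _ hz) (A0.smul_mem c hw0))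
    have hfin : (w1 - w0) * (z - algebraMap F A c) = 1 := by
      simp only [Algebra.algebraMap_eq_smul_one, mul_sub, sub_mul, mul_smul_comm, mul_one,
        smul_sub]
      have : (1 : A) = (1 : A) - 2 • (w0 * z + c • w1) := by rw [hodd]; simp
      rw [this, ← hv']
      abel
    apply hJ1
    rw [← hfin]
    exact Ideal.mul_mem_left _ _ hc
  have hJ : ∀ φ : FA F →ₐ[F] A, IsGSubst F A A0 A1 φ → φ f ∈ Jrad F A := by
    intro φ hφ
    choose α hα using fun i => dec (φ (yv F i))
    let Q : FA F →ₐ[F] Polynomial F := FreeAlgebra.lift F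
      (Sum.elim (fun i => Polynomial.C (α i) * Polynomial.X) (fun _ => 0))
    have hQ0 : (Q f).eval 0 = 0 := by
      have : (Polynomial.aeval (0 : F)).comp Q = constTerm F := by
        apply FreeAlgebra.hom_ext
        funext v
        rcases v with i | j <;> simp [Q, constTerm]
      have h' := DFunLike.congr_fun this f
      rw [hf0] at h'
      simpa [Polynomial.coe_aeval_eq_eval] using h'
    have hQc : ∀ a ∈ A0, Polynomial.aeval a (Q f) ∈ Subalgebra.center F A := by
      intro a ha
      have := hf ((Polynomial.aeval a).comp Q) ⟨fun i => ?_, fun j => ?_⟩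
      · exact (cent _).1 this
      · simp only [Q, yv, AlgHom.comp_apply, FreeAlgebra.lift_ι_apply, Sum.elim_inl, map_mul,
          Polynomial.aeval_C, Polynomial.aeval_X, ← Algebra.smul_def]
        exact A0.smul_mem _ ha
      · simp only [Q, zv, AlgHom.comp_apply, FreeAlgebra.lift_ι_apply, Sum.elim_inr, map_zero]
        exact A1.zero_mem
    have hQ : Q f = 0 := by
      rcases Nat.eq_zero_or_pos (Q f).natDegree with h0 | hpos
      · rw [Polynomial.eq_C_of_natDegree_eq_zero h0] at hQ0 ⊢
        rw [Polynomial.eval_C] at hQ0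
        rw [hQ0, Polynomial.C_0]
      · exfalso
        obtain ⟨n, hn⟩ := Nat.exists_eq_succ_of_ne_zero hpos.ne'
        apply hA0
        refine central_of_poly A0 hone n (Q f) hn.le ?_ hQc
        rw [← Nat.succ_eq_add_one, ← hn, Polynomial.coeff_natDegree, ne_eq,
          Polynomial.leadingCoeff_eq_zero]
        intro hz
        rw [hz] at hpos
        simp at hpos
    let I : Ideal A := (⊥ : Ideal A).jacobson
    have hcomp : (Ideal.Quotient.mkₐ F I).comp φ
        = ((Algebra.ofId F (A ⧸ I)).comp (Polynomial.aeval (1 : F))).comp Q := by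
      apply FreeAlgebra.hom_ext
      funext v
      rcases v with i | j
      · have h' : Ideal.Quotient.mk I (φ (yv F i)) = Ideal.Quotient.mk I (algebraMap F A (α i)) :=
          Ideal.Quotient.eq.2 (hα i)
        simp only [Q, Function.comp_apply, AlgHom.comp_apply, FreeAlgebra.lift_ι_apply,
          Sum.elim_inl, map_mul, Polynomial.aeval_C, Polynomial.aeval_X, map_one, mul_one]
        exact h'
      · have h' : Ideal.Quotient.mk I (φ (zv F j)) = 0 :=
          Ideal.Quotient.eq_zero_iff_mem.2 (hA1J _ (hφ.2 j))
        simp only [Q, Function.comp_apply, AlgHom.comp_apply, FreeAlgebra.lift_ι_apply,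
          Sum.elim_inr, map_zero]
        exact h'
    have h' := DFunLike.congr_fun hcomp f
    simp only [AlgHom.comp_apply, hQ, map_zero] at h'
    exact Ideal.Quotient.eq_zero_iff_mem.1 h'
  refine ⟨by rw [map_mul, map_mul, hf0, mul_zero, zero_mul], fun φ hφ => ?_⟩
  have hm : φ f ∈ Jprime F A := ⟨hJ φ hφ, (cent _).1 (hf φ hφ)⟩
  rw [cent, map_mul, map_mul]
  exact (hJ'ideal _ (hJ'ideal _ hm (φ g)).1 (φ h)).2.2
end

section
/- For every k ≥ 3, the center of the algebra N_k is Z(N_k) = span_F{I_k, e_{1k}}. -/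
theorem eMat_eq_single' (F : Type) [Field F] (k i j : ℕ) (hi : i < k) (hj : j < k) :
    eMat F k i j = Matrix.single (⟨i, hi⟩ : Fin k) (⟨j, hj⟩ : Fin k) (1 : F) := by
  ext a b
  simp only [eMat, Matrix.of_apply, Matrix.single_apply, Fin.ext_iff]
  simp only [eq_comm]

/-- for `k ≥ 3`, `Z(N_k) = span_F{I_k, e_{1k}}`. -/
theorem stmt4 (F : Type) [Field F] [CharZero F] (k : ℕ) (hk : 3 ≤ k) :
    centerIn F (Matrix (Fin k) (Fin k) F) (NkSub F k) =
      Submodule.span F {(1 : Matrix (Fin k) (Fin k) F), eMat F k 0 (k - 1)} := by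
  have h0 : 0 < k := by omega
  have hl : k - 1 < k := by omega
  apply le_antisymm
  · rintro x ⟨-, hx⟩
    have hE : x * EMat F k = EMat F k * x :=
      hx _ (Submodule.subset_span (Or.inl (Or.inr ⟨1, le_rfl, by omega, (pow_one _).symm⟩)))
    have he : ∀ j : Fin k, 1 ≤ (j : ℕ) →
        x * Matrix.single ⟨0, h0⟩ j 1 = Matrix.single ⟨0, h0⟩ j 1 * x := by
      intro j hj
      have := hx (eMat F k 0 j) (Submodule.subset_span (Or.inr ⟨j, hj, by omega, rfl⟩))
      rwa [eMat_eq_single' F k 0 j h0 j.2] at this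
    have hrow : ∀ j b : Fin k, 1 ≤ (j : ℕ) → b ≠ j → x j b = 0 := by
      intro j b hj hb
      have := congrFun (congrFun (he j hj) ⟨0, h0⟩) b
      rw [Matrix.mul_single_apply_of_ne (hbj := hb)] at this
      simpa using this.symm
    have hdiag : ∀ j : Fin k, 1 ≤ (j : ℕ) → x j j = x ⟨0, h0⟩ ⟨0, h0⟩ := by
      intro j hj
      have := congrFun (congrFun (he j hj) ⟨0, h0⟩) j
      simpa using this.symm
    have htop : ∀ c : Fin k, 1 ≤ (c : ℕ) → (c : ℕ) + 1 < k → x ⟨0, h0⟩ c = 0 := by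
      intro c hc hck
      have := congrFun (congrFun hE ⟨0, h0⟩) ⟨c + 1, hck⟩
      rw [Matrix.mul_apply, Matrix.mul_apply, Finset.sum_eq_single c,
        Finset.sum_eq_single ⟨1, by omega⟩] at this
      · rw [hrow ⟨1, by omega⟩ _ le_rfl (by simp [Fin.ext_iff]; omega)] at this
        simpa [EMat] using this
      · intro b _ hb
        have : ¬ (1 = (b : ℕ)) := fun h => hb (Fin.ext h.symm)
        simp [EMat, this]
      · simp
      · intro b _ hb
        have : ¬ ((b : ℕ) = c) := fun h => hb (Fin.ext h)
        simp [EMat, this]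
      · simp
    rw [Submodule.mem_span_pair]
    refine ⟨x ⟨0, h0⟩ ⟨0, h0⟩, x ⟨0, h0⟩ ⟨k - 1, hl⟩, ?_⟩
    ext a b
    simp only [Matrix.add_apply, Matrix.smul_apply, Matrix.one_apply, eMat, Matrix.of_apply,
      smul_eq_mul]
    by_cases ha : (a : ℕ) = 0
    · obtain rfl : a = ⟨0, h0⟩ := Fin.ext ha
      by_cases hb : (b : ℕ) = 0
      · obtain rfl : b = ⟨0, h0⟩ := Fin.ext hb
        have : ¬ (0 = k - 1) := by omega
        simp [this]
      · by_cases hb' : (b : ℕ) = k - 1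
        · obtain rfl : b = ⟨k - 1, hl⟩ := Fin.ext hb'
          have : ¬ (0 = k - 1) := by omega
          simp [this]
        · rw [htop b (by omega) (by omega)]
          have : ¬ (0 = (b : ℕ)) := by omega
          simp [hb', this, Fin.ext_iff]
    · by_cases hab : a = b
      · subst hab
        simp [ha, hdiag a (by omega)]
      · simp [ha, hab, hrow a b (by omega) (Ne.symm hab)]
  · rw [Submodule.span_le]
    rintro x (rfl | rfl)
    · exact ⟨Submodule.subset_span (Or.inl (Or.inl rfl)), fun y _ => by simp⟩
    · refine ⟨Submodule.subset_span (Or.inr ⟨k - 1, by omega, le_rfl, rfl⟩), fun y hy => ?_⟩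
      rw [eMat_eq_single' F k 0 (k - 1) h0 hl]
      have hl0 : (⟨k - 1, hl⟩ : Fin k) ≠ ⟨0, h0⟩ := by simp [Fin.ext_iff]; omega
      have e1 : Matrix.single ⟨0, h0⟩ ⟨k - 1, hl⟩ 1 * EMat F k = 0 := by
        ext a b
        by_cases ha : a = ⟨0, h0⟩
        · subst ha
          have : ¬ (k - 1 + 1 = (b : ℕ)) := by omega
          simp [EMat, this]
        · simp [ha]
      have e2 : EMat F k * Matrix.single ⟨0, h0⟩ ⟨k - 1, hl⟩ 1 = 0 := by
        ext a b
        by_cases hb : b = ⟨k - 1, hl⟩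
        · subst hb
          simp [EMat]
        · simp [hb]
      induction hy using Submodule.span_induction with
      | zero => simp
      | add a b _ _ ha hb => rw [mul_add, add_mul, ha, hb]
      | smul c a _ ha => rw [mul_smul_comm, smul_mul_assoc, ha]
      | mem y hy =>
        rcases hy with (rfl | ⟨m, hm, -, rfl⟩) | ⟨j, hj, hj', rfl⟩
        · simp
        · obtain ⟨n, rfl⟩ : ∃ n, m = n + 1 := ⟨m - 1, by omega⟩
          rw [pow_succ', ← mul_assoc, e1, ← pow_succ', pow_succ, mul_assoc, e2]
          simp
        · have hjk : j < k := by omega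
          rw [eMat_eq_single' F k 0 j h0 hjk, Matrix.single_mul_single_of_ne (h := hl0),
            Matrix.single_mul_single_of_ne]
          simp [Fin.ext_iff]; omega
end

section
/- For every k ≥ 3, C^gr(N_k) = Id^gr(N_{k−1}), where N_k and N_{k−1} are regarded as superalgebras with the trivial grading (N_k, 0) and (N_{k−1}, 0). -/
section Helpers

theorem EMat_app (F : Type) [Field F] (k : ℕ) (a b : Fin k) :
    EMat F k a b = if (a : ℕ) + 1 = b then 1 else 0 := rfl

theorem eMat_app (F : Type) [Field F] (k i j : ℕ) (a b : Fin k) :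
    eMat F k i j a b = if (a : ℕ) = i ∧ (b : ℕ) = j then 1 else 0 := rfl

theorem eMat_eq_single (F : Type) [Field F] (n : ℕ) (c : Fin (n+1)) :
    eMat F (n+1) 0 c = Matrix.single 0 c 1 := by
  ext a b
  rw [eMat_app, Matrix.single_apply]
  congr 1
  apply propext
  rw [Fin.ext_iff, Fin.ext_iff, Fin.val_zero]
  constructor <;> rintro ⟨h1, h2⟩ <;> exact ⟨h1.symm, h2.symm⟩

theorem EMat_pow_apply (F : Type) [Field F] (k m : ℕ) (a b : Fin k) :
    (EMat F k ^ m) a b = if (a : ℕ) + m = b then 1 else 0 := by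
  induction m generalizing a b with
  | zero => simp [Matrix.one_apply, Fin.ext_iff]
  | succ m ih =>
    rw [pow_succ, Matrix.mul_apply]
    simp only [ih, EMat_app]
    by_cases h : (a : ℕ) + (m + 1) = b
    · rw [if_pos h, Finset.sum_eq_single (⟨a + m, by omega⟩ : Fin k)]
      · rw [if_pos rfl, if_pos (by simp only []; omega), mul_one]
      · intro c _ hc
        rw [if_neg, zero_mul]
        intro h'; apply hc; ext; simp only []; omega
      · simp
    · rw [if_neg h]
      apply Finset.sum_eq_zero
      intro c _
      by_cases h1 : (a : ℕ) + m = c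
      · rw [if_neg (c := (c : ℕ) + 1 = b) (by omega), mul_zero]
      · rw [if_neg h1, zero_mul]

/-- upper left truncation -/
theorem trunc_mem (F : Type) [Field F] (n : ℕ) (hn : 2 ≤ n)
    (x : Matrix (Fin (n+1)) (Fin (n+1)) F) (hx : x ∈ NkSub F (n+1)) :
    x.submatrix Fin.castSucc Fin.castSucc ∈ NkSub F n := by
  induction hx using Submodule.span_induction with
  | zero => exact (NkSub F n).zero_mem
  | add x y _ _ hx hy => exact (NkSub F n).add_mem hx hy
  | smul c x _ hx => exact (NkSub F n).smul_mem c hx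
  | mem x hx =>
    rcases hx with (hx | ⟨m, h1, h2, rfl⟩) | ⟨j, h1, h2, rfl⟩
    · rw [Set.mem_singleton_iff] at hx
      subst hx
      apply Submodule.subset_span
      left; left
      rw [Set.mem_singleton_iff]
      ext a b
      simp [Matrix.one_apply]
    · by_cases h : m ≤ n - 2
      · apply Submodule.subset_span
        left; right
        refine ⟨m, h1, h, ?_⟩
        ext a b
        simp [EMat_pow_apply]
      · apply Submodule.subset_span
        right
        refine ⟨m, h1, by omega, ?_⟩
        ext a b
        simp only [Matrix.submatrix_apply, EMat_pow_apply, eMat, Matrix.of_apply,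
          Fin.val_castSucc]
        congr 1
        apply propext
        omega
    · by_cases h : j ≤ n - 1
      · apply Submodule.subset_span
        right
        refine ⟨j, h1, h, ?_⟩
        ext a b
        simp only [Matrix.submatrix_apply, eMat_app, Fin.val_castSucc]
      · convert (NkSub F n).zero_mem
        ext a b
        simp [eMat]
        omega

theorem trunc_surj (F : Type) [Field F] (n : ℕ) (hn : 2 ≤ n)
    (x : Matrix (Fin n) (Fin n) F) (hx : x ∈ NkSub F n) :
    ∃ z ∈ NkSub F (n+1), z.submatrix Fin.castSucc Fin.castSucc = x := by
  induction hx using Submodule.span_induction with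
  | zero => exact ⟨0, (NkSub F _).zero_mem, rfl⟩
  | add x y _ _ hx hy =>
    obtain ⟨z, hz, rfl⟩ := hx
    obtain ⟨w, hw, rfl⟩ := hy
    exact ⟨z + w, (NkSub F _).add_mem hz hw, rfl⟩
  | smul c x _ hx =>
    obtain ⟨z, hz, rfl⟩ := hx
    exact ⟨c • z, (NkSub F _).smul_mem c hz, rfl⟩
  | mem x hx =>
    rcases hx with (hx | ⟨m, h1, h2, rfl⟩) | ⟨j, h1, h2, rfl⟩
    · rw [Set.mem_singleton_iff] at hx
      subst hx
      refine ⟨1, Submodule.subset_span (Or.inl (Or.inl rfl)), ?_⟩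
      ext a b
      simp [Matrix.one_apply]
    · refine ⟨EMat F (n+1) ^ m,
        Submodule.subset_span (Or.inl (Or.inr ⟨m, h1, by omega, rfl⟩)), ?_⟩
      ext a b
      simp [EMat_pow_apply]
    · refine ⟨eMat F (n+1) 0 j, Submodule.subset_span (Or.inr ⟨j, h1, by omega, rfl⟩), ?_⟩
      ext a b
      simp only [Matrix.submatrix_apply, eMat_app, Fin.val_castSucc]

theorem upper_of_mem (F : Type) [Field F] (k : ℕ)
    (x : Matrix (Fin k) (Fin k) F) (hx : x ∈ NkSub F k) (a b : Fin k) (hab : b < a) :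
    x a b = 0 := by
  induction hx using Submodule.span_induction with
  | zero => rfl
  | add x y _ _ hx hy => simp [hx, hy]
  | smul c x _ hx => simp [hx]
  | mem x hx =>
    rcases hx with (hx | ⟨m, h1, h2, rfl⟩) | ⟨j, h1, h2, rfl⟩
    · rw [Set.mem_singleton_iff] at hx
      subst hx
      rw [Matrix.one_apply_ne hab.ne']
    · rw [EMat_pow_apply, if_neg]
      have : (b : ℕ) < a := hab
      omega
    · have : (b : ℕ) < a := hab
      simp [eMat]
      omega

theorem lower_of_mem (F : Type) [Field F] (n : ℕ)
    (x : Matrix (Fin (n+1)) (Fin (n+1)) F) (hx : x ∈ NkSub F (n+1)) :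
    ∃ p : Polynomial F, x.submatrix Fin.succ Fin.succ = Polynomial.aeval (EMat F n) p := by
  induction hx using Submodule.span_induction with
  | zero => exact ⟨0, by simp⟩
  | add x y _ _ hx hy =>
    obtain ⟨p, hp⟩ := hx
    obtain ⟨q, hq⟩ := hy
    exact ⟨p + q, by rw [map_add, ← hp, ← hq]; rfl⟩
  | smul c x _ hx =>
    obtain ⟨p, hp⟩ := hx
    exact ⟨c • p, by rw [map_smul, ← hp]; rfl⟩
  | mem x hx =>
    rcases hx with (hx | ⟨m, h1, h2, rfl⟩) | ⟨j, h1, h2, rfl⟩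
    · rw [Set.mem_singleton_iff] at hx
      subst hx
      refine ⟨1, ?_⟩
      ext a b
      simp [Matrix.one_apply]
    · refine ⟨Polynomial.X ^ m, ?_⟩
      ext a b
      simp only [map_pow, Polynomial.aeval_X, Matrix.submatrix_apply, EMat_pow_apply, Fin.val_succ]
      congr 1
      apply propext
      omega
    · refine ⟨0, ?_⟩
      ext a b
      simp [eMat]

theorem trunc_hom (F : Type) [Field F] (n : ℕ)
    (φ : FA F →ₐ[F] Matrix (Fin (n+1)) (Fin (n+1)) F) (ψ : FA F →ₐ[F] Matrix (Fin n) (Fin n) F)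
    (h : ∀ v, (∀ i j, φ (FreeAlgebra.ι F v) (Fin.castSucc i) (Fin.castSucc j)
        = ψ (FreeAlgebra.ι F v) i j) ∧
      ∀ j, φ (FreeAlgebra.ι F v) (Fin.last n) (Fin.castSucc j) = 0) (f : FA F) :
    (∀ i j, φ f (Fin.castSucc i) (Fin.castSucc j) = ψ f i j) ∧
      ∀ j, φ f (Fin.last n) (Fin.castSucc j) = 0 := by
  induction f using FreeAlgebra.induction with
  | grade0 r =>
    rw [AlgHom.commutes, AlgHom.commutes]
    simp [Matrix.algebraMap_matrix_apply, (Fin.castSucc_lt_last _).ne']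
  | grade1 v => exact h v
  | mul a b ha hb =>
    simp [Matrix.mul_apply, Fin.sum_univ_castSucc, ha.1, ha.2, hb.1, hb.2]
  | add a b ha hb => simp [ha.1, ha.2, hb.1, hb.2]

theorem lower_hom (F : Type) [Field F] (n : ℕ)
    (φ : FA F →ₐ[F] Matrix (Fin (n+1)) (Fin (n+1)) F) (ψ : FA F →ₐ[F] Matrix (Fin n) (Fin n) F)
    (h : ∀ v, (∀ i j, φ (FreeAlgebra.ι F v) (Fin.succ i) (Fin.succ j)
        = ψ (FreeAlgebra.ι F v) i j) ∧
      ∀ j, φ (FreeAlgebra.ι F v) (Fin.succ j) 0 = 0) (f : FA F) :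
    (∀ i j, φ f (Fin.succ i) (Fin.succ j) = ψ f i j) ∧
      ∀ j, φ f (Fin.succ j) 0 = 0 := by
  induction f using FreeAlgebra.induction with
  | grade0 r =>
    rw [AlgHom.commutes, AlgHom.commutes]
    simp [Matrix.algebraMap_matrix_apply]
  | grade1 v => exact h v
  | mul a b ha hb =>
    simp [Matrix.mul_apply, Fin.sum_univ_succ, ha.1, ha.2, hb.1, hb.2]
  | add a b ha hb => simp [ha.1, ha.2, hb.1, hb.2]

theorem corner_hom (F : Type) [Field F] (n : ℕ)
    (φ : FA F →ₐ[F] Matrix (Fin (n+1)) (Fin (n+1)) F) (ψ : FA F →ₐ[F] F)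
    (h : ∀ v, φ (FreeAlgebra.ι F v) 0 0 = ψ (FreeAlgebra.ι F v) ∧
      ∀ j, φ (FreeAlgebra.ι F v) (Fin.succ j) 0 = 0) (f : FA F) :
    φ f 0 0 = ψ f ∧ ∀ j, φ f (Fin.succ j) 0 = 0 := by
  induction f using FreeAlgebra.induction with
  | grade0 r =>
    rw [AlgHom.commutes, AlgHom.commutes]
    simp [Matrix.algebraMap_matrix_apply]
  | grade1 v => exact h v
  | mul a b ha hb =>
    simp [Matrix.mul_apply, Fin.sum_univ_succ, ha.1, ha.2, hb.1, hb.2]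
  | add a b ha hb => simp [ha.1, ha.2, hb.1, hb.2]

theorem gsubst_mem (F : Type) [Field F] (k : ℕ) (φ : FA F →ₐ[F] Matrix (Fin k) (Fin k) F)
    (h : IsGSubst F _ (NkSub F k) ⊥ φ) (v : ℕ ⊕ ℕ) : φ (FreeAlgebra.ι F v) ∈ NkSub F k := by
  rcases v with i | j
  · exact h.1 i
  · have := h.2 j
    rw [Submodule.mem_bot] at this
    change φ (zv F j) ∈ _
    rw [this]
    exact Submodule.zero_mem _

theorem hom_comp_eq (F : Type) [Field F] (A : Type) [Ring A] [Algebra F A] (φ ψ : FA F →ₐ[F] A)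
    (h : ∀ v, φ (FreeAlgebra.ι F v) = ψ (FreeAlgebra.ι F v)) (f : FA F) : φ f = ψ f := by
  have : φ = ψ := by
    apply FreeAlgebra.hom_ext
    funext v
    exact h v
  rw [this]

theorem EMat_mem (F : Type) [Field F] (k : ℕ) (hk : 3 ≤ k) : EMat F k ∈ NkSub F k :=
  Submodule.subset_span (Or.inl (Or.inr ⟨1, le_rfl, by omega, by rw [pow_one]⟩))

theorem one_mem_Nk (F : Type) [Field F] (k : ℕ) : (1 : Matrix (Fin k) (Fin k) F) ∈ NkSub F k :=
  Submodule.subset_span (Or.inl (Or.inl rfl))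

theorem center_rows (F : Type) [Field F] (n : ℕ)
    (x : Matrix (Fin (n+1)) (Fin (n+1)) F) (hx : ∀ y ∈ NkSub F (n+1), x * y = y * x)
    (j : Fin n) (l : Fin (n+1)) : x j.succ l = if l = j.succ then x 0 0 else 0 := by
  have h := hx (eMat F (n+1) 0 (j+1))
    (Submodule.subset_span (Or.inr ⟨j+1, by omega, by omega, rfl⟩))
  have e : eMat F (n+1) 0 (j+1) = Matrix.single 0 j.succ 1 :=
    eMat_eq_single F n j.succ
  rw [e] at h
  have h2 := congrFun (congrFun h 0) l
  rw [Matrix.single_mul_apply_same, one_mul] at h2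
  rw [← h2]
  split_ifs with hl
  · subst hl; simp
  · rw [Matrix.mul_single_apply_of_ne (hbj := hl)]

theorem center_block (F : Type) [Field F] (n : ℕ) (hn : 2 ≤ n)
    (x : Matrix (Fin (n+1)) (Fin (n+1)) F) (hx : ∀ y ∈ NkSub F (n+1), x * y = y * x)
    (a b : Fin n) : x a.castSucc b.castSucc = if a = b then x 0 0 else 0 := by
  obtain ⟨n, rfl⟩ : ∃ m, n = m + 1 := ⟨n - 1, by omega⟩
  induction a using Fin.cases with
  | succ a =>
    rw [← Fin.succ_castSucc, center_rows F _ x hx]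
    simp only [Fin.ext_iff, Fin.val_castSucc, Fin.val_succ, eq_comm]
  | zero =>
    have h := congrFun (congrFun (hx _ (EMat_mem F (n+1+1) (by omega))) 0) b.succ
    rw [Matrix.mul_apply, Matrix.mul_apply, Finset.sum_eq_single b.castSucc,
      Finset.sum_eq_single (Fin.succ 0)] at h
    · simp only [EMat, Matrix.of_apply] at h
      simp only [Fin.val_castSucc, Fin.val_succ, if_true, mul_one, Fin.val_zero, zero_add,
        one_mul] at h
      rw [Fin.castSucc_zero, h, center_rows F _ x hx]
      simp only [Fin.ext_iff, Fin.val_succ, Fin.val_zero]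
      congr 1
      apply propext
      omega
    · intro c _ hc
      have : ¬ (0 + 1 = (c : ℕ)) := fun h => hc (Fin.ext (by simpa using h.symm))
      rw [EMat_app, Fin.val_zero, if_neg this, zero_mul]
    · simp
    · intro c _ hc
      have : ¬ ((c : ℕ) + 1 = b + 1) := fun h => hc (Fin.ext (by simpa using h))
      simp only [EMat, Matrix.of_apply, Fin.val_succ, if_neg this, mul_zero]
    · simp

/-- entry of a polynomial in `s + E` -/
theorem aeval_entry (F : Type) [Field F] (n : ℕ) (s : F) (h : Polynomial F) :
    let M : Matrix (Fin (n+3)) (Fin (n+3)) F := algebraMap F _ s + EMat F (n+3)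
    Polynomial.aeval M h 1 2 = h.derivative.eval s := by
  intro M
  have e : Polynomial.aeval M h = Polynomial.aeval (EMat F (n+3)) (Polynomial.taylor s h) := by
    rw [Polynomial.taylor_apply, Polynomial.aeval_comp]
    simp [M, add_comm]
  rw [e, ← Polynomial.taylor_coeff_one, Polynomial.aeval_eq_sum_range, Matrix.sum_apply]
  simp only [Matrix.smul_apply, EMat_pow_apply, smul_eq_mul]
  rw [Finset.sum_eq_single 1]
  · have h2 : ((2 : Fin (n+3)) : ℕ) = 2 := rfl
    have h1 : ((1 : Fin (n+3)) : ℕ) = 1 := rfl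
    rw [h1, h2, if_pos rfl, mul_one]
  · intro b _ hb
    have h2 : ((2 : Fin (n+3)) : ℕ) = 2 := rfl
    have h1 : ((1 : Fin (n+3)) : ℕ) = 1 := rfl
    rw [h1, h2, if_neg (by omega), mul_zero]
  · intro hb
    rw [Polynomial.coeff_eq_zero_of_natDegree_lt, zero_mul]
    simp at hb ⊢
    omega

theorem scalar_vanish (F : Type) [Field F] [CharZero F] (n : ℕ) (hn : 2 ≤ n) (f : FA F)
    (hf : f ∈ CGr F (Matrix (Fin (n+1)) (Fin (n+1)) F) (NkSub F (n+1)) ⊥)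
    (a : ℕ ⊕ ℕ → F) (ha : ∀ j, a (Sum.inr j) = 0) : FreeAlgebra.lift F a f = 0 := by
  obtain ⟨n, rfl⟩ : ∃ m, n = m + 2 := ⟨n - 2, by omega⟩
  let H : FA F →ₐ[F] Polynomial F :=
    FreeAlgebra.lift F (fun v => Polynomial.C (a v) * Polynomial.X)
  have h0 : (H f).eval 0 = 0 := by
    refine Eq.trans ?_ hf.1
    refine hom_comp_eq F F ((Polynomial.aeval (0 : F)).comp H) (constTerm F) (fun v => ?_) f
    simp [H, constTerm]
  have h1 : (H f).eval 1 = FreeAlgebra.lift F a f := by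
    refine hom_comp_eq F F ((Polynomial.aeval (1 : F)).comp H) _ (fun v => ?_) f
    simp [H]
  have hd : (H f).derivative = 0 := by
    apply Polynomial.funext
    intro s
    rw [← aeval_entry F n s]
    have hc := hf.2 ((Polynomial.aeval
      (algebraMap F (Matrix (Fin (n+3)) (Fin (n+3)) F) s + EMat F (n+3))).comp H) ?_
    · have := center_rows F (n+2) _ (fun y hy => hc.2 y (Submodule.mem_sup_left hy)) 0 2
      rw [if_neg] at this
      · simpa using this
      · intro h; have h3 : (2 : ℕ) = 1 := congrArg Fin.val h
        omega
    · constructor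
      · intro i
        simp only [yv, H, AlgHom.comp_apply, FreeAlgebra.lift_ι_apply, map_mul,
          Polynomial.aeval_X, Polynomial.aeval_C]
        rw [← Algebra.smul_def]
        apply Submodule.smul_mem
        apply Submodule.add_mem
        · rw [Algebra.algebraMap_eq_smul_one]
          exact Submodule.smul_mem _ _ (one_mem_Nk F _)
        · exact EMat_mem F _ (by omega)
      · intro j
        simp [zv, H, ha]
  have := Polynomial.eq_C_of_derivative_eq_zero hd
  rw [← h1, this]
  rw [this] at h0
  simpa using h0

end Helpers

/-- for `k ≥ 3`, `C^gr(N_k) = Id^gr(N_{k-1})` (trivial gradings). -/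
theorem stmt5 (F : Type) [Field F] [CharZero F] (k : ℕ) (hk : 3 ≤ k) :
    CGr F (Matrix (Fin k) (Fin k) F) (NkSub F k) ⊥ =
      IdGr F (Matrix (Fin (k - 1)) (Fin (k - 1)) F) (NkSub F (k - 1)) ⊥ := by
  obtain ⟨n, rfl⟩ : ∃ m, k = m + 1 := ⟨k - 1, by omega⟩
  have hn : 2 ≤ n := by omega
  change CGr F (Matrix (Fin (n+1)) (Fin (n+1)) F) (NkSub F (n+1)) ⊥ =
      IdGr F (Matrix (Fin n) (Fin n) F) (NkSub F n) ⊥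
  ext f
  constructor
  · intro hf ψ hψ
    choose z hz hzt using fun i => trunc_surj F n hn _ (hψ.1 i)
    let φ : FA F →ₐ[F] Matrix (Fin (n+1)) (Fin (n+1)) F :=
      FreeAlgebra.lift F (Sum.elim z (fun _ => 0))
    have hφ : IsGSubst F _ (NkSub F (n+1)) ⊥ φ := by
      constructor
      · intro i
        simpa [φ, yv] using hz i
      · intro j
        simp [φ, zv]
    have hm := gsubst_mem F _ φ hφ
    have ht := trunc_hom F n φ ψ (by
      intro v
      refine ⟨?_, fun j => upper_of_mem F _ _ (hm v) _ _ (Fin.castSucc_lt_last j)⟩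
      intro a b
      rcases v with i | j
      · have := congrFun (congrFun (hzt i) a) b
        simpa [φ, yv] using this
      · have := hψ.2 j
        rw [Submodule.mem_bot] at this
        change _ = ψ (zv F j) a b
        rw [this]
        simp [φ]) f
    have hc := corner_hom F n φ (FreeAlgebra.lift F fun v => φ (FreeAlgebra.ι F v) 0 0) (by
      intro v
      refine ⟨by simp, fun j => upper_of_mem F _ _ (hm v) _ _ (Fin.succ_pos j)⟩) f
    rw [scalar_vanish F n hn f hf _ (by intro j; simp [φ])] at hc
    have hcen := hf.2 φ hφ
    ext a b
    rw [← ht.1, center_block F n hn _ (fun y hy => hcen.2 y (Submodule.mem_sup_left hy)), hc.1]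
    simp
  · intro hf
    -- vanishing on scalars
    have hs : ∀ a : ℕ ⊕ ℕ → F, (∀ j, a (Sum.inr j) = 0) → FreeAlgebra.lift F a f = 0 := by
      intro a ha
      let χ : FA F →ₐ[F] Matrix (Fin n) (Fin n) F :=
        (Algebra.ofId F (Matrix (Fin n) (Fin n) F)).comp (FreeAlgebra.lift F a)
      have h := hf χ (by
        constructor
        · intro i
          simp only [χ, yv, AlgHom.comp_apply, FreeAlgebra.lift_ι_apply, Algebra.ofId_apply]
          rw [Algebra.algebraMap_eq_smul_one]
          exact Submodule.smul_mem _ _ (one_mem_Nk F _)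
        · intro j
          simp [χ, zv, ha])
      have h2 := congrFun (congrFun h ⟨0, by omega⟩) ⟨0, by omega⟩
      simpa [χ, Algebra.ofId_apply, Matrix.algebraMap_matrix_apply] using h2
    refine ⟨?_, ?_⟩
    · exact hs (fun _ => 0) (fun _ => rfl)
    · intro φ hφ
      have hm := gsubst_mem F _ φ hφ
      -- upper left block
      have ht := trunc_hom F n φ (FreeAlgebra.lift F fun v =>
        (φ (FreeAlgebra.ι F v)).submatrix Fin.castSucc Fin.castSucc) (by
          intro v
          refine ⟨by simp, fun j => upper_of_mem F _ _ (hm v) _ _ (Fin.castSucc_lt_last j)⟩) f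
      rw [hf _ (by
        constructor
        · intro i
          simpa [yv] using trunc_mem F n hn _ (hm (Sum.inl i))
        · intro j
          have := hφ.2 j
          rw [Submodule.mem_bot] at this
          unfold zv at this
          simp [zv, this])] at ht
      -- lower right block
      choose p hp using fun i => lower_of_mem F n _ (hm (Sum.inl i))
      let H : FA F →ₐ[F] Polynomial F := FreeAlgebra.lift F (Sum.elim p (fun _ => 0))
      have hH : H f = 0 := by
        apply Polynomial.funext
        intro s
        rw [Polynomial.eval_zero, ← hs (fun v => (H (FreeAlgebra.ι F v)).eval s)
          (by intro j; simp [H])]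
        refine hom_comp_eq F F ((Polynomial.aeval s).comp H) _ (fun v => ?_) f
        simp
      have hl := lower_hom F n φ ((Polynomial.aeval (EMat F n)).comp H) (by
          intro v
          refine ⟨?_, fun j => upper_of_mem F _ _ (hm v) _ _ (Fin.succ_pos j)⟩
          intro a b
          rcases v with i | j
          · have := congrFun (congrFun (hp i) a) b
            simpa [H] using this
          · have := hφ.2 j
            rw [Submodule.mem_bot] at this
            change φ (zv F j) _ _ = _
            rw [this]
            simp [H]) f
      rw [AlgHom.comp_apply, hH, map_zero] at hl
      have key : φ f = (φ f 0 (Fin.last n)) • eMat F (n+1) 0 n := by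
        ext a b
        induction a using Fin.cases with
        | succ a =>
          induction b using Fin.cases with
          | zero => simp [hl.2, eMat]
          | succ b => simp [hl.1, eMat]
        | zero =>
          induction b using Fin.lastCases with
          | last => simp [eMat]
          | cast b =>
            have := ht.1 ⟨0, by omega⟩ b
            have hb := b.2.ne
            simp [eMat, hb]
            exact this
      have memE : eMat F (n+1) 0 n ∈ NkSub F (n+1) :=
        Submodule.subset_span (Or.inr ⟨n, by omega, by omega, rfl⟩)
      rw [key, sup_bot_eq]
      apply Submodule.smul_mem
      refine ⟨memE, fun y hy => ?_⟩
      have e : eMat F (n+1) 0 n = Matrix.single 0 (Fin.last n) 1 :=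
        eMat_eq_single F n (Fin.last n)
      rw [e]
      have hdiag : y (Fin.last n) (Fin.last n) = y 0 0 := by
        induction hy using Submodule.span_induction with
        | zero => rfl
        | add x y _ _ hx hy => simp [hx, hy]
        | smul c x _ hx => simp [hx]
        | mem x hx =>
          rcases hx with (hx | ⟨m, h1, h2, rfl⟩) | ⟨j, h1, h2, rfl⟩
          · rw [Set.mem_singleton_iff] at hx
            subst hx
            simp
          · rw [EMat_pow_apply, EMat_pow_apply, if_neg (by omega), if_neg (by omega)]
          · rw [eMat_app, eMat_app, if_neg, if_neg]
            · rw [Fin.val_zero]; omega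
            · rw [Fin.val_last]; omega
      have hup := upper_of_mem F _ y hy
      ext a b
      rw [Matrix.mul_apply, Matrix.mul_apply]
      rw [Finset.sum_eq_single (Fin.last n), Finset.sum_eq_single 0]
      · simp only [Matrix.single_apply]
        by_cases h1 : a = 0 <;> by_cases h2 : b = Fin.last n
        · simp [h1, h2, hdiag]
        · have := hup (Fin.last n) b (lt_of_le_of_ne (Fin.le_last b) h2)
          simp [h1, Ne.symm h2, this]
        · have := hup a 0 (Fin.pos_of_ne_zero h1)
          simp [Ne.symm h1, this]
        · simp [Ne.symm h1, Ne.symm h2]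
      · intro c _ hc
        simp [Matrix.single_apply, Ne.symm hc]
      · simp
      · intro c _ hc
        simp [Matrix.single_apply, Ne.symm hc]
      · simp
end
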